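/- arXiv:1112.5072 — 2 statements merged into one kernel-verified Lean document; each statement's English description precedes it below -/
import Mathlib

section
/- For $n \ge 1$ let $g(n) = \nu_2(2n)$ be the ruler function, where $\nu_2$ is the 2-adic valuation, and let $g^1 = (1, g(1), g(2), \ldots)$ be its extension to index $0$ by $g^1(0) = 1$. For $n \ge 1$ let $H_n^0(g^1)$ be the $n \times n$ Hankel matrix whose $(i,j)$ entry is $g^1(i+j-2)$ for $1 \le i, j \le n$. Then, for every $n \ge 1$, $\det H_n^0(g^1) \equiv 0 \pmod 2$ if $n \equiv 0$ or $3 \pmod 6$, and $\det H_n^0(g^1) \equiv 1 \pmod 2$ if $n \equiv 1, 2, 4,$ or $5 \pmod 6$. -/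
/-- The Hankel matrix `H_n^p(u)` of a sequence `u`: the `n × n` matrix whose
`(i, j)` entry (for `1 ≤ i, j ≤ n`) is `u (p + i + j - 2)`; the indices of `Fin n`
start at `0`, which absorbs the `- 2`. -/
def hankelMatrix (n p : ℕ) (u : ℕ → ℤ) : Matrix (Fin n) (Fin n) ℤ :=
  Matrix.of fun i j => u (p + i + j)

/-- The ruler function `g(n) = ν₂(2n)` extended to index `0` by `g¹(0) = 1`. -/
def ruler1 (n : ℕ) : ℤ := if n = 0 then 1 else (padicValNat 2 (2 * n) : ℤ)

open PowerSeries Finset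

section HankelPowerSeries

variable {R : Type*} [CommRing R]

/-- The determinant of the `n × n` Hankel matrix of the coefficients of a power series. -/
noncomputable def PowerSeries.hankelDet (F : R⟦X⟧) (n : ℕ) : R :=
  (Matrix.of fun i j : Fin n => coeff ((i : ℕ) + j) F).det

theorem Fin.sum_ite_le_eq_sum_range {n : ℕ} (i : Fin n) (f : ℕ → R) :
    ∑ k : Fin n, (if k ≤ i then f k else 0) = ∑ k ∈ range ((i : ℕ) + 1), f k := by
  simp only [Fin.le_def]
  rw [Fin.sum_univ_eq_sum_range (fun m : ℕ => if m ≤ (i : ℕ) then f m else 0),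
    ← Finset.sum_filter]
  refine Finset.sum_congr ?_ fun _ _ => rfl
  ext m
  have := i.isLt
  simp only [mem_filter, mem_range]
  omega

/-- If multiplying the Hankel matrix of `F` on the left by the lower triangular Toeplitz matrix
of `V` gives the product of `D` with the upper triangular Toeplitz matrix of `K`, and `V` and `K`
have constant coefficient `1`, then the Hankel matrix of `F` and `D` have the same determinant. -/
theorem PowerSeries.hankelDet_eq_det_of_toeplitz {F V K : R⟦X⟧} {D : ℕ → ℕ → R}
    (hV : coeff 0 V = 1) (hK : coeff 0 K = 1)
    (h : ∀ i j, ∑ k ∈ range (i + 1), coeff (i - k) V * coeff (k + j) F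
      = ∑ m ∈ range (j + 1), D i (j - m) * coeff m K) (n : ℕ) :
    F.hankelDet n = (Matrix.of fun i j : Fin n => D i j).det := by
  let L : Matrix (Fin n) (Fin n) R := Matrix.of fun i k => if k ≤ i then coeff (i - k : ℕ) V else 0
  let U : Matrix (Fin n) (Fin n) R := Matrix.of fun s j => if s ≤ j then coeff (j - s : ℕ) K else 0
  have hL : L.det = 1 := by
    rw [Matrix.det_of_isLowerTriangular]
    · simp [L, hV]
    · intro i j hij
      have : i < j := hij
      simp [L, not_le.2 this]
  have hU : U.det = 1 := by
    rw [Matrix.det_of_isUpperTriangular]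
    · simp [U, hK]
    · intro i j hij
      have : j < i := hij
      simp [U, not_le.2 this]
  have hLU : L * (Matrix.of fun i j : Fin n => coeff ((i : ℕ) + j) F)
      = (Matrix.of fun i j : Fin n => D i j) * U := by
    ext i j
    simp only [Matrix.mul_apply, Matrix.of_apply, L, U, ite_mul, mul_ite, zero_mul, mul_zero]
    rw [Fin.sum_ite_le_eq_sum_range i fun k => coeff (i - k : ℕ) V * coeff (k + j) F,
      Fin.sum_ite_le_eq_sum_range j fun s => D i s * coeff (j - s : ℕ) K, h,
      ← Finset.sum_range_reflect]
    refine Finset.sum_congr rfl fun m hm => ?_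
    have : m ≤ j := by simpa [Nat.lt_succ_iff] using hm
    congr 3
    omega
  have := congrArg Matrix.det hLU
  rwa [Matrix.det_mul, Matrix.det_mul, hL, hU, one_mul, mul_one] at this

theorem PowerSeries.sum_range_coeff_mul_coeff_add (F V : R⟦X⟧) (i j : ℕ) :
    ∑ k ∈ range (i + 1), coeff (i - k) V * coeff (k + j) F
      = coeff (i + j) (F * V) - ∑ m ∈ range j, coeff (i + j - m) V * coeff m F := by
  rw [coeff_mul, Finset.Nat.sum_antidiagonal_eq_sum_range_succ
    (fun a b => coeff a F * coeff b V), show (i + j).succ = j + (i + 1) by omega,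
    Finset.sum_range_add _ j (i + 1), eq_sub_iff_add_eq, add_comm]
  congr 1
  · exact Finset.sum_congr rfl fun m _ => mul_comm (coeff (i + j - m) V) (coeff m F)
  · refine Finset.sum_congr rfl fun k _ => ?_
    rw [mul_comm, add_comm j k, Nat.add_sub_add_right]

/-- One step of the J-fraction expansion. -/
theorem PowerSeries.hankelDet_succ {F V G : R⟦X⟧} {a : R} (hFV : F * V = 1)
    (hV : V = 1 + C a * X - X ^ 2 * G) (n : ℕ) : F.hankelDet (n + 1) = G.hankelDet n := by
  have hV0 : coeff 0 V = 1 := by simp [hV, mul_assoc, sq]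
  have hF0 : coeff 0 F = 1 := by
    have := congrArg (coeff 0) hFV
    rw [coeff_zero_eq_constantCoeff_apply, map_mul,
      ← coeff_zero_eq_constantCoeff_apply V, hV0] at this
    simpa using this
  have hVG : ∀ k, coeff (k + 2) V = - coeff k G := fun k => by
    rw [hV, map_sub, map_add, coeff_X_pow_mul, coeff_C_mul, coeff_one, coeff_X]
    simp
  let D : ℕ → ℕ → R
    | 0, 0 => 1
    | 0, _ + 1 => 0
    | _ + 1, 0 => 0
    | i + 1, j + 1 => coeff (i + j) G
  rw [hankelDet_eq_det_of_toeplitz (D := D) hV0 hF0]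
  · rw [Matrix.det_succ_row_zero, Fin.sum_univ_succ]
    simp [D, hankelDet, Matrix.submatrix]
  · rintro (_ | i) j
    · have hz : ∑ m ∈ range j, D 0 (j - m) * coeff m F = 0 := by
        refine Finset.sum_eq_zero fun m hm => ?_
        obtain ⟨s, hs⟩ := Nat.exists_eq_add_of_lt (mem_range.1 hm)
        rw [show j - m = s + 1 by omega]
        simp [D]
      rw [Finset.sum_range_succ _ j, hz]
      simp only [zero_add, Finset.sum_range_one, Nat.sub_self, hV0, D]
    · rw [sum_range_coeff_mul_coeff_add, hFV, Finset.sum_range_succ _ j, coeff_one,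
        if_neg (by omega), zero_sub, ← Finset.sum_neg_distrib]
      simp only [Nat.sub_self, D, zero_mul, add_zero]
      refine Finset.sum_congr rfl fun m hm => ?_
      obtain ⟨s, hs⟩ := Nat.exists_eq_add_of_lt (mem_range.1 hm)
      rw [show j - m = s + 1 by omega, show i + 1 + j - m = i + s + 2 by omega, hVG]
      simp

/-- One step of the continued fraction expansion at a vanishing Hankel determinant. -/
theorem PowerSeries.hankelDet_X_mul_add_two {K V G : R⟦X⟧} {a b : R} (hKV : K * V = 1)
    (hV : V = 1 + C a * X + C b * X ^ 2 - X ^ 3 * G) (n : ℕ) :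
    (X * K).hankelDet (n + 2) = - G.hankelDet n := by
  have hV0 : coeff 0 V = 1 := by simp [hV]
  have hV1 : coeff 1 V = a := by
    rw [hV, map_sub, map_add, map_add, coeff_X_pow_mul', coeff_C_mul, coeff_C_mul, coeff_one,
      coeff_X, coeff_X_pow]
    simp
  have hK0 : coeff 0 K = 1 := by
    have := congrArg (coeff 0) hKV
    rw [coeff_zero_eq_constantCoeff_apply, map_mul,
      ← coeff_zero_eq_constantCoeff_apply V, hV0] at this
    simpa using this
  have hVG : ∀ k, coeff (k + 3) V = - coeff k G := fun k => by
    rw [hV, map_sub, map_add, map_add, coeff_X_pow_mul, coeff_C_mul, coeff_C_mul, coeff_one,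
      coeff_X, coeff_X_pow]
    simp
  let D : ℕ → ℕ → R
    | 0, 1 => 1
    | 0, _ => 0
    | 1, 0 => 1
    | 1, 1 => a
    | 1, _ + 2 => 0
    | _ + 2, 0 => 0
    | _ + 2, 1 => 0
    | i + 2, j + 2 => coeff (i + j) G
  rw [hankelDet_eq_det_of_toeplitz (D := D) hV0 hK0]
  · rw [Matrix.det_succ_row_zero, Fin.sum_univ_succ, Fin.sum_univ_succ]
    simp only [D, Matrix.of_apply, Fin.val_zero, Fin.val_succ, zero_add, mul_zero, zero_mul,
      mul_one, pow_one, Finset.sum_const_zero, add_zero]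
    rw [Matrix.det_succ_row_zero, Fin.sum_univ_succ]
    simp [hankelDet, Matrix.submatrix]
  · rintro (_ | _ | i) (_ | j)
    · simp [D]
    · have hz : ∑ m ∈ range j, D 0 (j + 1 - m) * coeff m K = 0 := by
        refine Finset.sum_eq_zero fun m hm => ?_
        obtain ⟨s, hs⟩ := Nat.exists_eq_add_of_lt (mem_range.1 hm)
        rw [show j + 1 - m = s + 2 by omega]
        simp [D]
      rw [Finset.sum_range_succ _ (j + 1), Finset.sum_range_succ _ j, hz, Nat.add_sub_cancel_left,
        Nat.sub_self]
      simp only [zero_add, Finset.sum_range_one, Nat.sub_self, coeff_succ_X_mul, hV0, D]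
      ring
    · simp [D, Finset.sum_range_succ, hV0, hK0]
    · have hz : ∑ m ∈ range j, D 1 (j + 1 - m) * coeff m K = 0 := by
        refine Finset.sum_eq_zero fun m hm => ?_
        obtain ⟨s, hs⟩ := Nat.exists_eq_add_of_lt (mem_range.1 hm)
        rw [show j + 1 - m = s + 2 by omega]
        simp [D]
      rw [Finset.sum_range_succ _ (j + 1), Finset.sum_range_succ _ j, hz, Nat.add_sub_cancel_left,
        Nat.sub_self]
      simp only [zero_add, Finset.sum_range_succ, Finset.sum_range_zero, Nat.sub_self, Nat.sub_zero,
        coeff_succ_X_mul, add_comm 1 (j + 1), hV0, hV1, D]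
    · rw [sum_range_coeff_mul_coeff_add, mul_assoc, hKV, mul_one, coeff_X]
      simp [D]
    · rw [sum_range_coeff_mul_coeff_add, mul_assoc, hKV, mul_one, coeff_X, if_neg (by omega),
        Finset.sum_range_succ (fun m => D _ _ * _) (j + 1),
        Finset.sum_range_succ (fun m => D _ _ * _) j, Finset.sum_range_succ',
        zero_sub, Nat.add_sub_cancel_left, Nat.sub_self]
      simp only [D, coeff_succ_X_mul, coeff_zero_X_mul, zero_mul, mul_zero, add_zero,
        ← Finset.sum_neg_distrib]
      refine Finset.sum_congr rfl fun m hm => ?_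
      obtain ⟨s, hs⟩ := Nat.exists_eq_add_of_lt (mem_range.1 hm)
      rw [show j + 1 - m = s + 2 by omega,
        show i + 1 + 1 + (j + 1) - (m + 1) = i + s + 3 by omega, hVG]
      simp

end HankelPowerSeries

section Ruler

/-- The generating function of `ruler1` modulo `2`. -/
noncomputable def rulerSeries : (ZMod 2)⟦X⟧ := PowerSeries.mk fun n => (ruler1 n : ZMod 2)

theorem ruler1_odd (n : ℕ) : ruler1 (2 * n + 1) = 1 := by
  have h : padicValNat 2 (2 * n + 1) = 0 := padicValNat.eq_zero_of_not_dvd (by omega)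
  rw [ruler1, if_neg (by omega), padicValNat.mul (by omega) (by omega), h]
  simp

theorem ruler1_two_mul {n : ℕ} (hn : n ≠ 0) : ruler1 (2 * n) = ruler1 n + 1 := by
  rw [ruler1, ruler1, if_neg (by omega), if_neg hn, padicValNat.mul (by omega) (by omega)]
  simp [add_comm]

theorem rulerSeries_sq_add_self : rulerSeries ^ 2 + rulerSeries = X * PowerSeries.mk 1 := by
  have hsq : rulerSeries ^ 2 = rulerSeries.expand 2 two_ne_zero := by
    have h := MvPowerSeries.map_frobenius_expand 2 two_ne_zero (f := rulerSeries)
    rw [ZMod.frobenius_zmod] at h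
    simpa [PowerSeries.expand] using h.symm
  ext n
  rw [map_add, hsq, coeff_expand]
  obtain ⟨m, rfl | rfl⟩ := n.even_or_odd'
  · rcases eq_or_ne m 0 with rfl | hm
    · simp [rulerSeries, ruler1]
      decide
    · obtain ⟨k, rfl⟩ := Nat.exists_eq_succ_of_ne_zero hm
      rw [if_pos (dvd_mul_right 2 _), Nat.mul_div_cancel_left _ two_pos]
      simp only [rulerSeries, coeff_mk, ruler1_two_mul hm]
      rw [show 2 * k.succ = 2 * k + 1 + 1 by omega, coeff_succ_X_mul, coeff_mk]
      push_cast
      rw [← add_assoc, CharTwo.add_self_eq_zero]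
      simp
  · rw [if_neg (by omega), coeff_succ_X_mul]
    simp [rulerSeries, ruler1_odd]

theorem PowerSeries.two_eq_zero_of_zmod_two : (2 : (ZMod 2)⟦X⟧) = 0 := by
  rw [← map_ofNat (C : ZMod 2 →+* (ZMod 2)⟦X⟧) 2, show (OfNat.ofNat 2 : ZMod 2) = 0 from rfl,
    map_zero]

theorem one_add_X_mul_rulerSeries_sq_add_self :
    (1 + X) * (rulerSeries ^ 2 + rulerSeries) = X := by
  have h : (PowerSeries.mk 1 : (ZMod 2)⟦X⟧) * (1 - X) = 1 := mk_one_mul_one_sub_eq_one _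
  rw [rulerSeries_sq_add_self]
  linear_combination X * h + X ^ 2 * PowerSeries.mk 1 * two_eq_zero_of_zmod_two

theorem exists_rulerSeries_eq : ∃ W : (ZMod 2)⟦X⟧, rulerSeries = 1 + X + X ^ 3 * W := by
  have h : X ^ 3 ∣ rulerSeries - (1 + X) := by
    rw [X_pow_dvd_iff]
    intro m hm
    have h1 := ruler1_odd 0
    have h2 := ruler1_two_mul one_ne_zero
    simp only [mul_zero, zero_add, mul_one] at h1 h2
    interval_cases m
    · simp [rulerSeries, ruler1]
    · simp [rulerSeries, h1, coeff_one]
    · simp [rulerSeries, h2, h1, coeff_one, coeff_X]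
      decide
  obtain ⟨W, hW⟩ := h
  exact ⟨W, by rw [← hW]; ring⟩

/-- The Hankel determinants of the first J-fraction remainder of `rulerSeries` are periodic. -/
theorem exists_hankelDet_rulerSeries_succ : ∃ G : (ZMod 2)⟦X⟧,
    (∀ n, rulerSeries.hankelDet (n + 1) = G.hankelDet n) ∧
    (∀ n, G.hankelDet (n + 3) = G.hankelDet n) ∧
    G.hankelDet 0 = 1 ∧ G.hankelDet 1 = 1 ∧ G.hankelDet 2 = 0 := by
  obtain ⟨W, hW⟩ := exists_rulerSeries_eq
  have hF := one_add_X_mul_rulerSeries_sq_add_self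
  have h2 : (2 : (ZMod 2)⟦X⟧) = 0 := two_eq_zero_of_zmod_two
  have hX : (X : (ZMod 2)⟦X⟧) ≠ 0 := X_ne_zero
  have hG : (1 + X) * W * (rulerSeries + X) = 1 := by
    refine mul_left_cancel₀ (pow_ne_zero 3 hX) ?_
    rw [hW] at hF ⊢
    linear_combination hF - (1 + 2 * X + 2 * X ^ 2 + X ^ 3 + X ^ 3 * W + X ^ 4 * W) * h2
  have hstep : ∀ n, ((1 + X) * W).hankelDet (n + 1) = (X * W).hankelDet n :=
    hankelDet_succ (a := 0) hG (by
      rw [hW, map_zero]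
      linear_combination (X + X ^ 3 * W) * h2)
  have hstep' : ∀ n, (X * W).hankelDet (n + 2) = ((1 + X) * W).hankelDet n := fun n => by
    rw [hankelDet_X_mul_add_two (a := 1) (b := 0) (G := (1 + X) * W)
      (V := (1 + X) * (rulerSeries + X)) (by linear_combination hG), CharTwo.neg_eq]
    rw [hW, map_zero, map_one]
    linear_combination (X + X ^ 2 + X ^ 3 * W + X ^ 4 * W) * h2
  refine ⟨(1 + X) * W, hankelDet_succ (a := 1) (V := 1 + X + X ^ 2 * ((1 + X) * W)) ?_ ?_,
    fun n => ?_, ?_, ?_, ?_⟩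
  · refine mul_left_cancel₀ hX ?_
    rw [hW] at hF ⊢
    linear_combination hF - (1 + 2 * X + X ^ 2 + X ^ 3 * W + X ^ 4 * W) * h2
  · rw [map_one]
    linear_combination X ^ 2 * ((1 + X) * W) * h2
  · rw [hstep, hstep']
  · simp [hankelDet]
  · rw [hstep]
    simp [hankelDet]
  · rw [hstep]
    simp [hankelDet]

theorem hankelDet_rulerSeries_succ (n : ℕ) :
    rulerSeries.hankelDet (n + 1) = if n % 3 = 2 then 0 else 1 := by
  obtain ⟨G, hG, hper, h0, h1, h2⟩ := exists_hankelDet_rulerSeries_succ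
  rw [hG]
  induction n using Nat.strong_induction_on with
  | _ n ih =>
    match n with
    | 0 => simpa using h0
    | 1 => simpa using h1
    | 2 => simpa using h2
    | n + 3 => rw [hper, ih n (by omega), Nat.add_mod_right]

theorem intCast_det_hankelMatrix_ruler1 (n : ℕ) :
    ((hankelMatrix n 0 ruler1).det : ZMod 2) = rulerSeries.hankelDet n := by
  rw [← eq_intCast (Int.castRingHom (ZMod 2)), RingHom.map_det]
  congr 1
  ext i j
  simp [hankelMatrix, rulerSeries]

end Ruler

theorem det_hankel_ruler1_mod_two (n : ℕ) (hn : 1 ≤ n) :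
    ((n % 6 = 0 ∨ n % 6 = 3) → (hankelMatrix n 0 ruler1).det ≡ 0 [ZMOD 2]) ∧
    ((n % 6 = 1 ∨ n % 6 = 2 ∨ n % 6 = 4 ∨ n % 6 = 5) →
      (hankelMatrix n 0 ruler1).det ≡ 1 [ZMOD 2]) := by
  obtain ⟨m, rfl⟩ := Nat.exists_eq_add_of_le' hn
  have h := intCast_det_hankelMatrix_ruler1 (m + 1)
  rw [hankelDet_rulerSeries_succ] at h
  constructor
  · intro hm
    rw [if_pos (by omega)] at h
    exact (ZMod.intCast_eq_intCast_iff _ 0 2).1 (by simpa using h)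
  · intro hm
    rw [if_neg (by omega)] at h
    exact (ZMod.intCast_eq_intCast_iff _ 1 2).1 (by simpa using h)
end

section
/- For $n\ge 1$ let $g(n)=\nu_2(2n)$ be the $2$-adic valuation of $2n$ (the ruler function), and let $\mathbf g^1=(g^1(j))_{j\ge 0}$ be its extension to index $0$, i.e. $g^1(0)=1$ and $g^1(j)=g(j)$ for $j\ge 1$. Let $H_n^0(\mathbf g^1)$ be the $n\times n$ Hankel matrix whose $(i,j)$ entry is $g^1(i+j-2)$ for $1\le i,j\le n$, and for an $n\times n$ matrix $A$ let $\overline{A}$ be the $(n+1)\times(n+1)$ matrix whose upper-left $n\times n$ block is $A$ and whose last row and last column have all entries equal to $1$, except that the $(n+1,n+1)$ entry is $0$. Then for every $n\ge 1$, $$\det\overline{H_n^0(\mathbf g^1)}\equiv\begin{cases}0\pmod 2 & \text{if } n\equiv 4,5\pmod 6,\\ 1\pmod 2 & \text{if } n\equiv 0,1,2,3\pmod 6.\end{cases}$$ -/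
/-- The bordered matrix `overline{A}`: the `(n+1) × (n+1)` matrix whose upper-left
`n × n` block is `A`, whose last row and last column have all entries `1`, except
that the bottom-right corner entry is `0`. -/
def border {R : Type*} [Zero R] [One R] {n : ℕ} (A : Matrix (Fin n) (Fin n) R) :
    Matrix (Fin (n + 1)) (Fin (n + 1)) R :=
  Matrix.of fun i j =>
    if hi : (i : ℕ) < n then
      if hj : (j : ℕ) < n then A ⟨i, hi⟩ ⟨j, hj⟩ else 1
    else if (j : ℕ) < n then 1 else 0

open Matrix

section ZModTwo

variable {ι κ μ ν ρ : Type*}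

/-- The all-ones matrix modulo two. -/
def onesMatrix (ι κ : Type*) : Matrix ι κ (ZMod 2) := Matrix.of fun _ _ => 1

@[simp] theorem onesMatrix_apply (i : ι) (j : κ) : onesMatrix ι κ i j = 1 := rfl

/-- A matrix with an additional column of ones. -/
def colBorder (A : Matrix ι κ (ZMod 2)) : Matrix ι (κ ⊕ Fin 1) (ZMod 2) :=
  Matrix.fromCols A (onesMatrix ι (Fin 1))

/-- A matrix bordered by ones, with corner entry zero, in block form. -/
def blockBorder (A : Matrix ι κ (ZMod 2)) : Matrix (ι ⊕ Fin 1) (κ ⊕ Fin 1) (ZMod 2) :=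
  fromBlocks A (onesMatrix ι (Fin 1)) (onesMatrix (Fin 1) κ) 0

theorem onesMatrix_mul_onesMatrix :
    onesMatrix ι (Fin 1) * onesMatrix (Fin 1) κ = onesMatrix ι κ := by
  ext i j
  simp [Matrix.mul_apply]

variable [Fintype ι] [DecidableEq ι] [Fintype κ] [DecidableEq κ]

/-- Modulo two, the determinant of a rectangularly indexed square matrix does not depend on
the chosen identifications of the index types. -/
theorem det_submatrix_equiv_zmod_two (M : Matrix μ ν (ZMod 2)) (e₁ : ι ≃ μ) (e₂ : ι ≃ ν)
    (e₁' : κ ≃ μ) (e₂' : κ ≃ ν) :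
    (M.submatrix e₁ e₂).det = (M.submatrix e₁' e₂').det := by
  have key : M.submatrix e₁ e₂ =
      ((M.submatrix e₁' e₂').submatrix (e₁.trans e₁'.symm) (e₁.trans e₁'.symm)).submatrix id
        ((e₂.trans e₂'.symm).trans (e₁.trans e₁'.symm).symm) := by
    ext i j
    simp
  rw [key, det_permute', det_submatrix_equiv_self]
  rcases Int.units_eq_one_or
    (Equiv.Perm.sign ((e₂.trans e₂'.symm).trans (e₁.trans e₁'.symm).symm)) with h | h <;>
  · rw [h]
    simp

theorem det_blockBorder_add_ones (A : Matrix ι ι (ZMod 2)) :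
    (blockBorder (A + onesMatrix ι ι)).det = (blockBorder A).det := by
  have h : blockBorder (A + onesMatrix ι ι) =
      fromBlocks 1 (onesMatrix ι (Fin 1)) 0 1 * blockBorder A := by
    simp [blockBorder, fromBlocks_multiply, onesMatrix_mul_onesMatrix]
  rw [h, det_mul, det_fromBlocks_zero₂₁]
  simp

theorem det_colBorder_add_ones (A : Matrix ι κ (ZMod 2)) (e : ι ≃ κ ⊕ Fin 1) :
    ((colBorder (A + onesMatrix ι κ)).submatrix id e).det =
      ((colBorder A).submatrix id e).det := by
  have h : colBorder (A + onesMatrix ι κ) =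
      colBorder A * (fromBlocks 1 0 (onesMatrix (Fin 1) κ) 1 :
        Matrix (κ ⊕ Fin 1) (κ ⊕ Fin 1) (ZMod 2)) := by
    simp [colBorder, fromCols_mul_fromBlocks, onesMatrix_mul_onesMatrix]
  rw [h, ← submatrix_mul_equiv _ _ id e e, det_mul, det_submatrix_equiv_self,
    det_fromBlocks_zero₁₂]
  simp

theorem det_fromBlocks_last_row_add (A : Matrix ι ι (ZMod 2)) (B : Matrix ι (Fin 1) (ZMod 2))
    (C C' : Matrix (Fin 1) ι (ZMod 2)) (D D' : Matrix (Fin 1) (Fin 1) (ZMod 2)) :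
    (fromBlocks A B (C + C') (D + D')).det =
      (fromBlocks A B C D).det + (fromBlocks A B C' D').det := by
  have h : ∀ (C : Matrix (Fin 1) ι (ZMod 2)) (D : Matrix (Fin 1) (Fin 1) (ZMod 2)),
      fromBlocks A B C D =
        (fromBlocks A B 0 0).updateRow (Sum.inr 0) (Sum.elim (C 0) (D 0)) := by
    intro C D
    ext i j
    rcases i with i | i
    · rw [updateRow_ne (by simp)]
      rcases j with j | j <;> rfl
    · rw [Subsingleton.elim i 0, updateRow_self]
      rcases j with j | j <;> rfl
  rw [h, h C D, h C' D', ← det_updateRow_add]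
  congr 2
  ext j
  rcases j with j | j <;> rfl

theorem det_add_ones (A : Matrix ι ι (ZMod 2)) :
    (A + onesMatrix ι ι).det = A.det + (blockBorder A).det := by
  have h := det_fromBlocks_last_row_add A (onesMatrix ι (Fin 1)) (onesMatrix (Fin 1) ι) 0 0 1
  rw [add_zero, zero_add, det_fromBlocks_one₂₂, onesMatrix_mul_onesMatrix,
    det_fromBlocks_zero₂₁, det_one, mul_one, ZModModule.sub_eq_add] at h
  rw [h, add_comm]
  rfl

theorem det_blockBorder_fromBlocks_diagonal (A : Matrix ι ι (ZMod 2)) (B : Matrix κ κ (ZMod 2)) :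
    (blockBorder (fromBlocks A 0 0 B)).det =
      (blockBorder A).det * B.det + A.det * (blockBorder B).det := by
  have h := det_fromBlocks_last_row_add (fromBlocks A 0 0 B) (onesMatrix (ι ⊕ κ) (Fin 1))
    (fromCols (onesMatrix (Fin 1) ι) 0) (fromCols 0 (onesMatrix (Fin 1) κ)) 0 0
  have h₀ : blockBorder (fromBlocks A 0 0 B) =
      fromBlocks (fromBlocks A 0 0 B) (onesMatrix (ι ⊕ κ) (Fin 1))
        (fromCols (onesMatrix (Fin 1) ι) 0 + fromCols 0 (onesMatrix (Fin 1) κ)) (0 + 0) := by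
    ext i j
    rcases i with (i | i) | i <;> rcases j with (j | j) | j <;> simp [blockBorder]
  rw [h₀, h]
  congr 1
  · let e : (ι ⊕ Fin 1) ⊕ κ ≃ (ι ⊕ κ) ⊕ Fin 1 :=
      ((Equiv.sumAssoc ι (Fin 1) κ).trans
        (Equiv.sumCongr (Equiv.refl ι) (Equiv.sumComm (Fin 1) κ))).trans
        (Equiv.sumAssoc ι κ (Fin 1)).symm
    rw [← det_submatrix_equiv_self e]
    have : (fromBlocks (fromBlocks A 0 0 B) (onesMatrix (ι ⊕ κ) (Fin 1))
        (fromCols (onesMatrix (Fin 1) ι) 0) 0).submatrix e e =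
        fromBlocks (blockBorder A) 0 (fromCols 0 (onesMatrix κ (Fin 1))) B := by
      ext i j
      rcases i with (i | i) | i <;> rcases j with (j | j) | j <;> simp [e, blockBorder]
    rw [this, det_fromBlocks_zero₁₂]
  · rw [← det_submatrix_equiv_self (Equiv.sumAssoc ι κ (Fin 1)).symm]
    have : (fromBlocks (fromBlocks A 0 0 B) (onesMatrix (ι ⊕ κ) (Fin 1))
        (fromCols 0 (onesMatrix (Fin 1) κ)) 0).submatrix (Equiv.sumAssoc ι κ (Fin 1)).symm
          (Equiv.sumAssoc ι κ (Fin 1)).symm =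
        fromBlocks A (fromCols 0 (onesMatrix ι (Fin 1))) 0 (blockBorder B) := by
      ext i j
      rcases i with i | i | i <;> rcases j with j | j | j <;> simp [blockBorder]
    rw [this, det_fromBlocks_zero₂₁]

theorem det_fromBlocks_antidiagonal (B : Matrix ι κ (ZMod 2)) (C : Matrix κ ι (ZMod 2))
    (D : Matrix κ κ (ZMod 2)) (e : ι ≃ κ) :
    (fromBlocks 0 B C D).det = (B.submatrix id e).det * (C.submatrix e id).det := by
  have h : (fromBlocks 0 B C D).det =
      ((fromBlocks 0 B C D).submatrix (Equiv.sumCongr (Equiv.refl ι) e)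
        ((Equiv.sumComm ι ι).trans (Equiv.sumCongr (Equiv.refl ι) e))).det :=
    det_submatrix_equiv_zmod_two _ (Equiv.refl _) (Equiv.refl _) _ _
  have h' : (fromBlocks 0 B C D).submatrix (Equiv.sumCongr (Equiv.refl ι) e)
        ((Equiv.sumComm ι ι).trans (Equiv.sumCongr (Equiv.refl ι) e)) =
      fromBlocks (B.submatrix id e) 0 (D.submatrix e e) (C.submatrix e id) := by
    ext i j
    rcases i with i | i <;> rcases j with j | j <;> simp
  rw [h, h', det_fromBlocks_zero₁₂]

theorem det_blockBorder_fromBlocks_antidiagonal_self (B : Matrix ι ι (ZMod 2)) :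
    (blockBorder (fromBlocks 0 B B 0)).det = 0 := by
  have h := det_fromBlocks_last_row_add (fromBlocks 0 B B 0) (onesMatrix (ι ⊕ ι) (Fin 1))
    (fromCols (onesMatrix (Fin 1) ι) 0) (fromCols 0 (onesMatrix (Fin 1) ι)) 0 0
  have h₀ : blockBorder (fromBlocks 0 B B 0) =
      fromBlocks (fromBlocks 0 B B 0) (onesMatrix (ι ⊕ ι) (Fin 1))
        (fromCols (onesMatrix (Fin 1) ι) 0 + fromCols 0 (onesMatrix (Fin 1) ι)) (0 + 0) := by
    ext i j
    rcases i with (i | i) | i <;> rcases j with (j | j) | j <;> simp [blockBorder]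
  let e := Equiv.sumCongr (Equiv.sumComm ι ι) (Equiv.refl (Fin 1))
  have h₁ : (fromBlocks (fromBlocks 0 B B 0) (onesMatrix (ι ⊕ ι) (Fin 1))
        (fromCols 0 (onesMatrix (Fin 1) ι)) 0).submatrix e e =
      fromBlocks (fromBlocks 0 B B 0) (onesMatrix (ι ⊕ ι) (Fin 1))
        (fromCols (onesMatrix (Fin 1) ι) 0) 0 := by
    ext i j
    rcases i with (i | i) | i <;> rcases j with (j | j) | j <;> simp [e]
  rw [h₀, h, ← h₁, det_submatrix_equiv_self]
  exact CharTwo.add_self_eq_zero _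

theorem det_fromBlocks_antidiagonal_of_card_lt (B : Matrix ι κ (ZMod 2)) (C : Matrix κ ι (ZMod 2))
    (hlt : Fintype.card κ < Fintype.card ι) : (fromBlocks 0 B C 0).det = 0 := by
  have hker : LinearMap.ker (Matrix.mulVecLin C) ≠ ⊥ :=
    LinearMap.ker_ne_bot_of_finrank_lt (by simpa using hlt)
  obtain ⟨v, hv, hv0⟩ := (Submodule.ne_bot_iff _).1 hker
  rw [← exists_mulVec_eq_zero_iff]
  refine ⟨Sum.elim v 0, fun h => hv0 ?_, ?_⟩
  · funext i
    exact congrFun h (Sum.inl i)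
  · have hv' : C *ᵥ v = 0 := hv
    rw [fromBlocks_mulVec]
    ext i
    rcases i with i | i <;> simp [hv']

theorem det_blockBorder_fromBlocks_antidiagonal (B : Matrix ι κ (ZMod 2)) (e : ι ≃ κ ⊕ Fin 1) :
    (blockBorder (fromBlocks 0 B Bᵀ 0)).det = ((colBorder B).submatrix id e).det ^ 2 := by
  rw [← det_submatrix_equiv_self (Equiv.sumAssoc ι κ (Fin 1)).symm]
  have : (blockBorder (fromBlocks 0 B Bᵀ 0)).submatrix (Equiv.sumAssoc ι κ (Fin 1)).symm
        (Equiv.sumAssoc ι κ (Fin 1)).symm =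
      fromBlocks 0 (colBorder B) (colBorder B)ᵀ (blockBorder 0) := by
    ext i j
    rcases i with i | i | i <;> rcases j with j | j | j <;> simp [blockBorder, colBorder]
  rw [this, det_fromBlocks_antidiagonal _ _ _ e, sq, ← transpose_submatrix, det_transpose]

theorem det_colBorder_fromBlocks_antidiagonal [Fintype μ] [DecidableEq μ] [Fintype ν]
    [DecidableEq ν] (B : Matrix ι ρ (ZMod 2)) (C : Matrix μ μ (ZMod 2))
    (e : ν ≃ ι ⊕ μ) (e' : ν ≃ (μ ⊕ ρ) ⊕ Fin 1) (e'' : ι ≃ ρ ⊕ Fin 1) :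
    ((colBorder (fromBlocks 0 B C 0)).submatrix e e').det =
      ((colBorder B).submatrix id e'').det * C.det := by
  let s : ι ⊕ μ ≃ (μ ⊕ ρ) ⊕ Fin 1 :=
    ((Equiv.sumCongr e'' (Equiv.refl μ)).trans (Equiv.sumComm _ _)).trans
      (Equiv.sumAssoc μ ρ (Fin 1)).symm
  rw [det_submatrix_equiv_zmod_two _ e e' (Equiv.refl _) s]
  have : (colBorder (fromBlocks 0 B C 0)).submatrix (Equiv.refl _) s =
      fromBlocks ((colBorder B).submatrix id e'') 0
        ((fromCols 0 (onesMatrix μ (Fin 1))).submatrix id e'') C := by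
    ext i j
    rcases j with j | j
    · rcases h : e'' j with k | k <;> rcases i with i | i <;> simp [s, h, colBorder]
    · rcases i with i | i <;> simp [s, colBorder]
  rw [this, det_fromBlocks_zero₁₂]

end ZModTwo

/-- Splitting `Fin n` into its even and odd elements. -/
noncomputable def parityEquiv {p q n : ℕ} (h₁ : q ≤ p) (h₂ : p ≤ q + 1) (h : n = p + q) :
    Fin p ⊕ Fin q ≃ Fin n :=
  Equiv.ofBijective
    (Sum.elim (fun i => ⟨2 * i, by omega⟩) (fun i => ⟨2 * i + 1, by omega⟩))
    ⟨by
      rintro (i | i) (j | j) hij <;>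
        simp only [Sum.elim_inl, Sum.elim_inr, Sum.inl.injEq, Sum.inr.injEq,
          Fin.ext_iff, reduceCtorEq] at hij ⊢ <;> omega,
    by
      intro k
      rcases Nat.even_or_odd' (k : ℕ) with ⟨i, hi | hi⟩
      · exact ⟨Sum.inl ⟨i, by omega⟩, by simp [Fin.ext_iff, hi]⟩
      · exact ⟨Sum.inr ⟨i, by omega⟩, by simp [Fin.ext_iff, hi]⟩⟩

@[simp] theorem parityEquiv_inl {p q n : ℕ} (h₁ : q ≤ p) (h₂ : p ≤ q + 1) (h : n = p + q)
    (i : Fin p) : (parityEquiv h₁ h₂ h (Sum.inl i) : ℕ) = 2 * i := rfl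

@[simp] theorem parityEquiv_inr {p q n : ℕ} (h₁ : q ≤ p) (h₂ : p ≤ q + 1) (h : n = p + q)
    (i : Fin q) : (parityEquiv h₁ h₂ h (Sum.inr i) : ℕ) = 2 * i + 1 := rfl

/-- The rectangular Hankel matrix modulo two with entries `f (s + i + j)`. -/
def rectHankel (f : ℕ → ZMod 2) (s m n : ℕ) : Matrix (Fin m) (Fin n) (ZMod 2) :=
  Matrix.of fun i j => f (s + i + j)

theorem rectHankel_transpose (f : ℕ → ZMod 2) (s m n : ℕ) :
    (rectHankel f s m n)ᵀ = rectHankel f s n m := by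
  ext i j
  simp [rectHankel, add_right_comm]

/-- The recursion satisfied by the ruler function modulo two at positive indices. -/
structure IsRulerModTwo (f : ℕ → ZMod 2) : Prop where
  odd : ∀ n, f (2 * n + 1) = 1
  even : ∀ n, 0 < n → f (2 * n) = f n + 1

namespace IsRulerModTwo

variable {f f' : ℕ → ZMod 2}

theorem rectHankel_one_submatrix (hf : IsRulerModTwo f) {p q m p' q' n : ℕ}
    (h₁ : q ≤ p) (h₂ : p ≤ q + 1) (h : m = p + q)
    (h₁' : q' ≤ p') (h₂' : p' ≤ q' + 1) (h' : n = p' + q') :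
    (rectHankel f 1 m n).submatrix (parityEquiv h₁ h₂ h) (parityEquiv h₁' h₂' h') =
      fromBlocks 0 (rectHankel f 1 p q') (rectHankel f 1 q p') 0 + onesMatrix _ _ := by
  ext i j
  rcases i with i | i <;> rcases j with j | j <;>
    simp only [submatrix_apply, rectHankel, of_apply, parityEquiv_inl, parityEquiv_inr,
      Matrix.add_apply, fromBlocks_apply₁₁, fromBlocks_apply₁₂, fromBlocks_apply₂₁,
      fromBlocks_apply₂₂, onesMatrix_apply, Matrix.zero_apply, zero_add]
  · rw [← hf.odd (i + j)]; congr 1; ring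
  · rw [← hf.even _ (by omega)]; congr 1; ring
  · rw [← hf.even _ (by omega)]; congr 1; ring
  · rw [← hf.odd (i + j + 1)]; congr 1; ring

theorem rectHankel_zero_submatrix (hf : IsRulerModTwo f) (h₀ : f 0 = f' 0 + 1)
    (hff' : ∀ n, 0 < n → f n = f' n) {p q n : ℕ}
    (h₁ : q ≤ p) (h₂ : p ≤ q + 1) (h : n = p + q) :
    (rectHankel f 0 n n).submatrix (parityEquiv h₁ h₂ h) (parityEquiv h₁ h₂ h) =
      fromBlocks (rectHankel f' 0 p p) 0 0 (rectHankel f 1 q q) + onesMatrix _ _ := by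
  have he : ∀ n, f (2 * n) = f' n + 1 := by
    intro n
    rcases Nat.eq_zero_or_pos n with rfl | hn
    · exact h₀
    · rw [hf.even n hn, hff' n hn]
  ext i j
  rcases i with i | i <;> rcases j with j | j <;>
    simp only [submatrix_apply, rectHankel, of_apply, parityEquiv_inl, parityEquiv_inr,
      Matrix.add_apply, fromBlocks_apply₁₁, fromBlocks_apply₁₂, fromBlocks_apply₂₁,
      fromBlocks_apply₂₂, onesMatrix_apply, Matrix.zero_apply, zero_add]
  · rw [← he]; congr 1; ring
  · rw [← hf.odd (i + j)]; congr 1; ring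
  · rw [← hf.odd (i + j)]; congr 1; ring
  · rw [← hf.even _ (by omega)]; congr 1; ring

end IsRulerModTwo

theorem det_blockBorder_submatrix {ι κ : Type*} [Fintype ι] [DecidableEq ι] [Fintype κ]
    [DecidableEq κ] (A : Matrix ι ι (ZMod 2)) (e : κ ≃ ι) :
    (blockBorder (A.submatrix e e)).det = (blockBorder A).det := by
  rw [← det_submatrix_equiv_self (Equiv.sumCongr e (Equiv.refl (Fin 1))) (blockBorder A)]
  congr 1
  ext i j
  rcases i with i | i <;> rcases j with j | j <;> simp [blockBorder]

namespace IsRulerModTwo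

variable {f f' : ℕ → ZMod 2}

theorem det_rectHankel_one_even (hf : IsRulerModTwo f) (m : ℕ) :
    (rectHankel f 1 (2 * m) (2 * m)).det = (rectHankel f 1 m m).det ^ 2 := by
  rw [← det_submatrix_equiv_self (parityEquiv le_rfl (Nat.le_succ m) (two_mul m)),
    hf.rectHankel_one_submatrix, det_add_ones, det_blockBorder_fromBlocks_antidiagonal_self,
    det_fromBlocks_antidiagonal _ _ _ (Equiv.refl _), add_zero, sq]
  rfl

theorem det_blockBorder_rectHankel_one_even (hf : IsRulerModTwo f) (m : ℕ) :
    (blockBorder (rectHankel f 1 (2 * m) (2 * m))).det = 0 := by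
  rw [← det_blockBorder_submatrix _ (parityEquiv le_rfl (Nat.le_succ m) (two_mul m)),
    hf.rectHankel_one_submatrix, det_blockBorder_add_ones,
    det_blockBorder_fromBlocks_antidiagonal_self]

theorem det_blockBorder_rectHankel_one_odd (hf : IsRulerModTwo f) (m : ℕ) :
    (blockBorder (rectHankel f 1 (2 * m + 1) (2 * m + 1))).det =
      ((colBorder (rectHankel f 1 (m + 1) m)).submatrix id finSumFinEquiv.symm).det ^ 2 := by
  rw [← det_blockBorder_submatrix _
      (parityEquiv (Nat.le_succ m) le_rfl (show 2 * m + 1 = (m + 1) + m by omega)),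
    hf.rectHankel_one_submatrix, det_blockBorder_add_ones, ← rectHankel_transpose f 1 (m + 1) m,
    det_blockBorder_fromBlocks_antidiagonal _ finSumFinEquiv.symm]

theorem det_rectHankel_one_odd (hf : IsRulerModTwo f) (m : ℕ) :
    (rectHankel f 1 (2 * m + 1) (2 * m + 1)).det =
      ((colBorder (rectHankel f 1 (m + 1) m)).submatrix id finSumFinEquiv.symm).det ^ 2 := by
  rw [← det_submatrix_equiv_self
      (parityEquiv (Nat.le_succ m) le_rfl (show 2 * m + 1 = (m + 1) + m by omega)),
    hf.rectHankel_one_submatrix, det_add_ones, ← rectHankel_transpose f 1 (m + 1) m,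
    det_blockBorder_fromBlocks_antidiagonal _ finSumFinEquiv.symm,
    det_fromBlocks_antidiagonal_of_card_lt _ _ (by simp), zero_add]

theorem det_colBorder_rectHankel_one (hf : IsRulerModTwo f) {m k q : ℕ} (h₁ : q ≤ k + 1)
    (h₂ : k ≤ q) (h : m = q + k) :
    ((colBorder (rectHankel f 1 (m + 1) m)).submatrix id finSumFinEquiv.symm).det =
      ((colBorder (rectHankel f 1 (k + 1) k)).submatrix id finSumFinEquiv.symm).det *
        (rectHankel f 1 q q).det := by
  let r : Fin (k + 1) ⊕ Fin q ≃ Fin (m + 1) := parityEquiv h₁ (by omega) (by omega)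
  let c : Fin q ⊕ Fin k ≃ Fin m := parityEquiv h₂ h₁ h
  let e : Fin (k + 1) ⊕ Fin q ≃ (Fin q ⊕ Fin k) ⊕ Fin 1 :=
    (r.trans finSumFinEquiv.symm).trans (Equiv.sumCongr c.symm (Equiv.refl _))
  have hs : (colBorder (rectHankel f 1 (m + 1) m)).submatrix r
        (Equiv.sumCongr c (Equiv.refl (Fin 1))) =
      colBorder ((rectHankel f 1 (m + 1) m).submatrix r c) := by
    ext i j
    rcases j with j | j <;> simp [colBorder]
  refine (det_submatrix_equiv_zmod_two _ (Equiv.refl _) finSumFinEquiv.symm r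
    (e.trans (Equiv.sumCongr c (Equiv.refl (Fin 1))))).trans ?_
  rw [show (colBorder (rectHankel f 1 (m + 1) m)).submatrix r
        (e.trans (Equiv.sumCongr c (Equiv.refl (Fin 1)))) =
      ((colBorder (rectHankel f 1 (m + 1) m)).submatrix r
        (Equiv.sumCongr c (Equiv.refl (Fin 1)))).submatrix id e from rfl,
    hs, hf.rectHankel_one_submatrix, det_colBorder_add_ones]
  exact det_colBorder_fromBlocks_antidiagonal _ _ (Equiv.refl _) e finSumFinEquiv.symm

theorem det_rectHankel_one_and_colBorder (hf : IsRulerModTwo f) (n : ℕ) :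
    (rectHankel f 1 n n).det = 1 ∧
      ((colBorder (rectHankel f 1 (n + 1) n)).submatrix id finSumFinEquiv.symm).det = 1 := by
  induction n using Nat.strong_induction_on with
  | _ n ih =>
    have hdet : (rectHankel f 1 n n).det = 1 := by
      rcases Nat.even_or_odd' n with ⟨m, rfl | rfl⟩
      · rcases Nat.eq_zero_or_pos m with rfl | hm
        · exact det_fin_zero
        · rw [hf.det_rectHankel_one_even, (ih m (by omega)).1, one_pow]
      · rcases Nat.eq_zero_or_pos m with rfl | hm
        · rw [det_fin_one]
          exact hf.odd 0
        · rw [hf.det_rectHankel_one_odd, (ih m (by omega)).2, one_pow]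
    refine ⟨hdet, ?_⟩
    rcases Nat.eq_zero_or_pos n with rfl | hn
    · rw [det_fin_one]
      rfl
    · have hq : (rectHankel f 1 ((n + 1) / 2) ((n + 1) / 2)).det = 1 := by
        rcases (show (n + 1) / 2 < n ∨ (n + 1) / 2 = n by omega) with h | h
        · exact (ih _ h).1
        · rw [h, hdet]
      rw [hf.det_colBorder_rectHankel_one (k := n / 2) (q := (n + 1) / 2) (by omega) (by omega)
        (by omega), (ih (n / 2) (by omega)).2, hq, one_mul]

theorem det_blockBorder_rectHankel_one (hf : IsRulerModTwo f) (n : ℕ) :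
    (blockBorder (rectHankel f 1 n n)).det = if n % 2 = 0 then 0 else 1 := by
  rcases Nat.even_or_odd' n with ⟨m, rfl | rfl⟩
  · rw [hf.det_blockBorder_rectHankel_one_even, if_pos (by omega)]
  · rw [hf.det_blockBorder_rectHankel_one_odd, (hf.det_rectHankel_one_and_colBorder m).2,
      if_neg (by omega), one_pow]

theorem det_blockBorder_rectHankel_zero (hf : IsRulerModTwo f) (h₀ : f 0 = f' 0 + 1)
    (hff' : ∀ n, 0 < n → f n = f' n) {p q n : ℕ}
    (h₁ : q ≤ p) (h₂ : p ≤ q + 1) (h : n = p + q) :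
    (blockBorder (rectHankel f 0 n n)).det = (blockBorder (rectHankel f' 0 p p)).det +
      (rectHankel f' 0 p p).det * if q % 2 = 0 then 0 else 1 := by
  rw [← det_blockBorder_submatrix _ (parityEquiv h₁ h₂ h),
    hf.rectHankel_zero_submatrix h₀ hff', det_blockBorder_add_ones,
    det_blockBorder_fromBlocks_diagonal, (hf.det_rectHankel_one_and_colBorder q).1,
    hf.det_blockBorder_rectHankel_one, mul_one]

theorem det_rectHankel_zero (hf : IsRulerModTwo f) (h₀ : f 0 = f' 0 + 1)
    (hff' : ∀ n, 0 < n → f n = f' n) {p q n : ℕ}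
    (h₁ : q ≤ p) (h₂ : p ≤ q + 1) (h : n = p + q) :
    (rectHankel f 0 n n).det =
      (rectHankel f' 0 p p).det + (blockBorder (rectHankel f 0 n n)).det := by
  rw [← det_blockBorder_submatrix _ (parityEquiv h₁ h₂ h),
    ← det_submatrix_equiv_self (parityEquiv h₁ h₂ h) (rectHankel f 0 n n),
    hf.rectHankel_zero_submatrix h₀ hff', det_add_ones, det_blockBorder_add_ones,
    det_fromBlocks_zero₂₁, (hf.det_rectHankel_one_and_colBorder q).1, mul_one]

/-- The four interlocking determinant sequences of the ruler sequences with initial values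
`1` (for `f`) and `0` (for `f'`). -/
theorem det_rectHankel_zero_values (hf : IsRulerModTwo f) (hf' : IsRulerModTwo f')
    (h1 : f 0 = 1) (h0 : f' 0 = 0) (hff' : ∀ n, 0 < n → f n = f' n) (n : ℕ) (hn : 1 ≤ n) :
    (rectHankel f 0 n n).det = (if n % 3 = 0 then 0 else 1) ∧
    (blockBorder (rectHankel f 0 n n)).det = (if n % 6 = 4 ∨ n % 6 = 5 then 0 else 1) ∧
    (rectHankel f' 0 n n).det = (if n % 3 = 1 then 0 else 1) ∧
    (blockBorder (rectHankel f' 0 n n)).det = (if n % 6 = 2 ∨ n % 6 = 3 then 0 else 1) := by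
  induction n using Nat.strong_induction_on with
  | _ n ih =>
    rcases (show n = 1 ∨ 2 ≤ n by omega) with rfl | hn2
    · have hb : ∀ g : ℕ → ZMod 2, (blockBorder (rectHankel g 0 1 1)).det = 1 := by
        intro g
        rw [← det_submatrix_equiv_self finSumFinEquiv.symm, det_fin_two]
        have e0 : (finSumFinEquiv.symm (0 : Fin (1 + 1)) : Fin 1 ⊕ Fin 1) = Sum.inl 0 := rfl
        have e1 : (finSumFinEquiv.symm (1 : Fin (1 + 1)) : Fin 1 ⊕ Fin 1) = Sum.inr 0 := rfl
        simp [blockBorder, e0, e1]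
      simp only [hb]
      simp [rectHankel, h1, h0]
    · have hp₁ : n / 2 ≤ (n + 1) / 2 := by omega
      have hp₂ : (n + 1) / 2 ≤ n / 2 + 1 := by omega
      have hp : n = (n + 1) / 2 + n / 2 := by omega
      have hh : f 0 = f' 0 + 1 := by rw [h1, h0, zero_add]
      have hh' : f' 0 = f 0 + 1 := by rw [h1, h0]; rfl
      have hff := fun n hn => (hff' n hn).symm
      obtain ⟨ha, hb, ha', hb'⟩ := ih ((n + 1) / 2) (by omega) (by omega)
      rw [hf.det_rectHankel_zero hh hff' hp₁ hp₂ hp,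
        hf'.det_rectHankel_zero hh' hff hp₁ hp₂ hp,
        hf.det_blockBorder_rectHankel_zero hh hff' hp₁ hp₂ hp,
        hf'.det_blockBorder_rectHankel_zero hh' hff hp₁ hp₂ hp, ha, hb, ha', hb']
      have hlt : n % 12 < 12 := Nat.mod_lt _ (by norm_num)
      obtain ⟨k, r, hr, rfl⟩ : ∃ k r, r < 12 ∧ n = 12 * k + r :=
        ⟨n / 12, n % 12, hlt, by omega⟩
      rw [show (12 * k + r) / 2 % 2 = r / 2 % 2 by omega,
        show ((12 * k + r + 1) / 2) % 6 = (r + 1) / 2 % 6 by omega,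
        show ((12 * k + r + 1) / 2) % 3 = (r + 1) / 2 % 3 by omega,
        show (12 * k + r) % 6 = r % 6 by omega, show (12 * k + r) % 3 = r % 3 by omega]
      clear * - hr
      revert r
      decide

end IsRulerModTwo

theorem isRulerModTwo_ruler1 : IsRulerModTwo fun n => (ruler1 n : ZMod 2) := by
  constructor
  · intro n
    have : padicValNat 2 (2 * n + 1) = 0 := padicValNat.eq_zero_of_not_dvd (by omega)
    simp [ruler1, this]
  · intro n hn
    simp [ruler1, hn.ne']

theorem det_border_hankelMatrix_cast (n : ℕ) (u : ℕ → ℤ) :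
    ((border (hankelMatrix n 0 u)).det : ZMod 2) =
      (blockBorder (rectHankel (fun k => (u k : ZMod 2)) 0 n n)).det := by
  rw [Int.cast_det, ← det_submatrix_equiv_self finSumFinEquiv]
  congr 1
  ext i j
  rcases i with i | i <;> rcases j with j | j <;>
    simp [border, blockBorder, hankelMatrix, rectHankel]

theorem det_border_hankel_ruler1_mod_two (n : ℕ) (hn : 1 ≤ n) :
    ((n % 6 = 4 ∨ n % 6 = 5) → (border (hankelMatrix n 0 ruler1)).det ≡ 0 [ZMOD 2]) ∧
    ((n % 6 = 0 ∨ n % 6 = 1 ∨ n % 6 = 2 ∨ n % 6 = 3) →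
      (border (hankelMatrix n 0 ruler1)).det ≡ 1 [ZMOD 2]) := by
  have hf := isRulerModTwo_ruler1
  let f' : ℕ → ZMod 2 := fun n => if n = 0 then 0 else (ruler1 n : ZMod 2)
  have hf' : IsRulerModTwo f' := by
    refine ⟨fun k => ?_, fun k hk => ?_⟩
    · simpa [f'] using hf.odd k
    · simpa [f', hk.ne'] using hf.even k hk
  have h := (hf.det_rectHankel_zero_values hf' (by simp [ruler1]) (by simp [f'])
    (fun k hk => by simp [f', hk.ne']) n hn).2.1
  rw [← det_border_hankelMatrix_cast] at h
  constructor
  · intro hc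
    rw [if_pos hc] at h
    refine (ZMod.intCast_eq_intCast_iff _ _ 2).1 ?_
    simpa using h
  · intro hc
    rw [if_neg (by omega)] at h
    refine (ZMod.intCast_eq_intCast_iff _ _ 2).1 ?_
    simpa using h
end
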